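/- Let T>0 and let (u,P) be a solution of the incompressible Euler equation on [0,T]×ℝ³ (as in the context) with vorticity ω = curl u. Let (γ,ξ,b) be a solution of the bicharacteristic-amplitude system along u on [0,T], and assume ⟨ω(0,γ(0)), ξ(0)⟩ = 0. Then the quantity t ↦ ⟨ω(t,γ(t)), b(t)⟩ is constant on [0,T]. -/

import Mathlib

noncomputable section

open MeasureTheory Set
open scoped RealInnerProductSpace ENNReal

abbrev E3 := EuclideanSpace ℝ (Fin 3)

/-- The `i`-th standard basis vector of `ℝ³`. -/
def e3 (i : Fin 3) : E3 := EuclideanSpace.single i 1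

/-- The spatial partial derivative `∂ⱼ fᵢ (x)`. -/
def pd3 (f : E3 → E3) (j i : Fin 3) (x : E3) : ℝ := fderiv ℝ f x (e3 j) i

/-- The curl of a vector field on `ℝ³`. -/
def curl3 (f : E3 → E3) (x : E3) : E3 :=
  (WithLp.equiv 2 (Fin 3 → ℝ)).symm
    ![pd3 f 1 2 x - pd3 f 2 1 x, pd3 f 2 0 x - pd3 f 0 2 x, pd3 f 0 1 x - pd3 f 1 0 x]

/-- The divergence of a vector field on `ℝ³`. -/
def div3 (f : E3 → E3) (x : E3) : ℝ := ∑ i, pd3 f i i x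

/-- The transpose of the spatial Jacobian of `f` at `x`, applied to `ξ`:
`(∂ₓf(x))ᵀ ξ`, where `(∂ₓf)_{ij} = ∂ⱼfᵢ`. -/
def jacT (f : E3 → E3) (x ξ : E3) : E3 :=
  (WithLp.equiv 2 (Fin 3 → ℝ)).symm (fun i => ⟪ξ, fderiv ℝ f x (e3 i)⟫)

/-- The cross product on `ℝ³`. -/
def cross3 (a b : E3) : E3 :=
  (WithLp.equiv 2 (Fin 3 → ℝ)).symm
    ![a 1 * b 2 - a 2 * b 1, a 2 * b 0 - a 0 * b 2, a 0 * b 1 - a 1 * b 0]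

/-- `(u, P)` is a solution of the incompressible Euler equation on `[0,T] × ℝ³`:
`u` is C¹ in time and C² in space, `u` and its first and second spatial derivatives are
continuous and bounded on `[0,T] × ℝ³`, and `∂ₜu + (u·∇)u + ∇P = 0`, `div u = 0` hold
pointwise on `[0,T] × ℝ³`. -/
structure IsEulerSolutionOn (u : ℝ → E3 → E3) (P : ℝ → E3 → ℝ) (T : ℝ) : Prop where
  u_time_C1 : ∀ x, ContDiff ℝ 1 fun t => u t x
  u_space_C2 : ∀ t, ContDiff ℝ 2 (u t)
  cont_u : Continuous fun q : ℝ × E3 => u q.1 q.2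
  cont_du : Continuous fun q : ℝ × E3 => fderiv ℝ (u q.1) q.2
  cont_d2u : Continuous fun q : ℝ × E3 => fderiv ℝ (fderiv ℝ (u q.1)) q.2
  bdd : ∃ C : ℝ, ∀ t ∈ Icc 0 T, ∀ x : E3, ‖u t x‖ ≤ C ∧ ‖fderiv ℝ (u t) x‖ ≤ C ∧
      ‖fderiv ℝ (fderiv ℝ (u t)) x‖ ≤ C
  P_space_C1 : ∀ t, ContDiff ℝ 1 (P t)
  momentum : ∀ t ∈ Icc 0 T, ∀ x : E3,
      deriv (fun s => u s x) t + fderiv ℝ (u t) x (u t x) + gradient (P t) x = 0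
  incompressible : ∀ t ∈ Icc 0 T, ∀ x : E3, div3 (u t) x = 0

/-- `(v, P')` is a solution of the linearization of the Euler equation about `u`
on `[0,T] × ℝ³`: `v` is C¹, `P'` is C¹ in space, and
`∂ₜv + (u·∇)v + (v·∇)u + ∇P' = 0`, `div v = 0` hold pointwise on `[0,T] × ℝ³`. -/
structure IsLinEulerSolutionOn (u v : ℝ → E3 → E3) (P' : ℝ → E3 → ℝ) (T : ℝ) : Prop where
  v_C1 : ContDiff ℝ 1 fun q : ℝ × E3 => v q.1 q.2
  P'_space_C1 : ∀ t, ContDiff ℝ 1 (P' t)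
  momentum : ∀ t ∈ Icc 0 T, ∀ x : E3,
      deriv (fun s => v s x) t + fderiv ℝ (v t) x (u t x) + fderiv ℝ (u t) x (v t x)
        + gradient (P' t) x = 0
  incompressible : ∀ t ∈ Icc 0 T, ∀ x : E3, div3 (v t) x = 0

/-- `(γ, ξ, b)` is a solution of the bicharacteristic-amplitude system along `u` on `[0,T]`:
`ξ(t) ≠ 0`, `γ' = u(t,γ)`, `ξ' = −(∂ₓu)ᵀξ`, and
`b' = −(∂ₓu)b + 2 (⟨ξ, (∂ₓu)b⟩/|ξ|²) ξ` along `γ`. -/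
structure IsBicharSolution (u : ℝ → E3 → E3) (T : ℝ) (γ ξ b : ℝ → E3) : Prop where
  xi_ne : ∀ t ∈ Icc 0 T, ξ t ≠ 0
  hgamma : ∀ t ∈ Icc 0 T, HasDerivAt γ (u t (γ t)) t
  hxi : ∀ t ∈ Icc 0 T, HasDerivAt ξ (-jacT (u t) (γ t) (ξ t)) t
  hb : ∀ t ∈ Icc 0 T, HasDerivAt b
      (-(fderiv ℝ (u t) (γ t) (b t)) +
        (2 * ⟪ξ t, fderiv ℝ (u t) (γ t) (b t)⟫ / ‖ξ t‖ ^ 2) • ξ t) t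

open Topology Filter

/-- The convective term `(u·∇)u` at fixed time. -/
def convF (f : E3 → E3) (x : E3) : E3 := fderiv ℝ f x (f x)

/-- The spatial derivative of the convective term. -/
def convF' (f : E3 → E3) (x : E3) : E3 →L[ℝ] E3 :=
  (fderiv ℝ f x).comp (fderiv ℝ f x) +
    (ContinuousLinearMap.flipₗᵢ ℝ E3 E3 E3 (fderiv ℝ (fderiv ℝ f) x)) (f x)

lemma convF_hasFDerivAt {f : E3 → E3} (hf : ContDiff ℝ 2 f) (x : E3) :
    HasFDerivAt (convF f) (convF' f x) x := by
  have h1 : HasFDerivAt f (fderiv ℝ f x) x :=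
    (hf.differentiable (by norm_num) x).hasFDerivAt
  have h2 : HasFDerivAt (fderiv ℝ f) (fderiv ℝ (fderiv ℝ f) x) x := by
    have : ContDiff ℝ 1 (fderiv ℝ f) := hf.fderiv_right (by norm_num)
    exact (this.differentiable (by norm_num) x).hasFDerivAt
  exact h2.clm_apply h1

lemma convF'_apply (f : E3 → E3) (x v : E3) :
    convF' f x v = fderiv ℝ f x (fderiv ℝ f x v) + fderiv ℝ (fderiv ℝ f) x v (f x) := rfl

lemma cont_convF {u : ℝ → E3 → E3} {P : ℝ → E3 → ℝ} {T : ℝ} (hu : IsEulerSolutionOn u P T) :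
    Continuous fun q : ℝ × E3 => convF (u q.1) q.2 :=
  hu.cont_du.clm_apply hu.cont_u

lemma cont_convF' {u : ℝ → E3 → E3} {P : ℝ → E3 → ℝ} {T : ℝ} (hu : IsEulerSolutionOn u P T) :
    Continuous fun q : ℝ × E3 => convF' (u q.1) q.2 := by
  unfold convF'
  exact (hu.cont_du.clm_comp hu.cont_du).add
    (((ContinuousLinearMap.flipₗᵢ ℝ E3 E3 E3).continuous.comp hu.cont_d2u).clm_apply hu.cont_u)

lemma convF'_bound {f : E3 → E3} {x : E3} {C : ℝ} (h : ‖f x‖ ≤ C ∧ ‖fderiv ℝ f x‖ ≤ C ∧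
      ‖fderiv ℝ (fderiv ℝ f) x‖ ≤ C) : ‖convF' f x‖ ≤ C * C + C * C := by
  obtain ⟨h1, h2, h3⟩ := h
  have hC : 0 ≤ C := (norm_nonneg _).trans h1
  unfold convF'
  refine (norm_add_le _ _).trans (add_le_add ?_ ?_)
  · refine (ContinuousLinearMap.opNorm_comp_le _ _).trans ?_
    gcongr
  · refine (ContinuousLinearMap.le_opNorm _ _).trans ?_
    rw [LinearIsometryEquiv.norm_map]
    gcongr

lemma int_convF_hasFDerivAt {u : ℝ → E3 → E3} {P : ℝ → E3 → ℝ} {T : ℝ}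
    (hu : IsEulerSolutionOn u P T) {t : ℝ} (ht : t ∈ Icc 0 T) (x : E3) :
    HasFDerivAt (fun y => ∫ s in (0:ℝ)..t, convF (u s) y)
      (∫ s in (0:ℝ)..t, convF' (u s) x) x := by
  obtain ⟨C, hC⟩ := hu.bdd
  have c1 : ∀ y, Continuous fun s => convF (u s) y := fun y =>
    (cont_convF hu).comp (by fun_prop : Continuous fun s : ℝ => (s, y))
  have c2 : ∀ y, Continuous fun s => convF' (u s) y := fun y =>
    (cont_convF' hu).comp (by fun_prop : Continuous fun s : ℝ => (s, y))
  refine intervalIntegral.hasFDerivAt_integral_of_dominated_of_fderiv_le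
    (F := fun y s => convF (u s) y) (F' := fun y s => convF' (u s) y) (s := univ)
    (bound := fun _ => C * C + C * C) univ_mem ?_ ?_ ?_ ?_ ?_ ?_
  · exact Eventually.of_forall fun y => (c1 y).aestronglyMeasurable
  · exact (c1 x).intervalIntegrable _ _
  · exact (c2 x).aestronglyMeasurable
  · refine Eventually.of_forall fun s hs y _ => convF'_bound (hC s ?_ y)
    rw [uIoc_of_le ht.1] at hs
    exact ⟨hs.1.le, hs.2.trans ht.2⟩
  · exact intervalIntegrable_const
  · exact Eventually.of_forall fun s _ y _ => convF_hasFDerivAt (hu.u_space_C2 s) y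

/-- Differentiation under the integral for a time-dependent potential whose gradient is
continuous in time for each point and locally bounded. -/
lemma potential_hasFDerivAt {p : ℝ → E3 → ℝ} {t r N : ℝ} (ht : 0 ≤ t) {x0 : E3}
    (hp : ∀ s, ContDiff ℝ 1 (p s))
    (hc : ∀ y, ContinuousOn (fun s => fderiv ℝ (p s) y) (Icc 0 t))
    (hb : ∀ y ∈ Metric.ball x0 r, ∀ s ∈ Icc 0 t, ‖fderiv ℝ (p s) y‖ ≤ N)
    {x : E3} (hx : x ∈ Metric.ball x0 r) :
    HasFDerivAt (fun y => ∫ s in (0:ℝ)..t, (p s y - p s x0))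
      (∫ s in (0:ℝ)..t, fderiv ℝ (p s) x) x := by
  have hr : 0 < r := Metric.pos_of_mem_ball hx
  have hdiff : ∀ s y, HasFDerivAt (p s) (fderiv ℝ (p s) y) y := fun s y =>
    ((hp s).differentiable (by norm_num) y).hasFDerivAt
  have key : ∀ y ∈ Metric.ball x0 r, ContinuousOn (fun s => p s y - p s x0) (Icc 0 t) := by
    intro y hy
    have hseg : ∀ l ∈ Icc (0:ℝ) 1, x0 + l • (y - x0) ∈ Metric.ball x0 r := by
      intro l hl
      rw [mem_ball_iff_norm, add_sub_cancel_left, norm_smul, Real.norm_of_nonneg hl.1]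
      rw [mem_ball_iff_norm] at hy
      nlinarith [hl.2, norm_nonneg (y - x0)]
    have hrep : ∀ s, p s y - p s x0
        = ∫ l in (0:ℝ)..1, fderiv ℝ (p s) (x0 + l • (y - x0)) (y - x0) := by
      intro s
      have hd : ∀ l ∈ uIcc (0:ℝ) 1, HasDerivAt (fun l : ℝ => p s (x0 + l • (y - x0)))
          (fderiv ℝ (p s) (x0 + l • (y - x0)) (y - x0)) l := by
        intro l _
        have h1 : HasDerivAt (fun l : ℝ => x0 + l • (y - x0)) (y - x0) l := by
          simpa using ((hasDerivAt_id l).smul_const (y - x0)).const_add x0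
        exact (hdiff s _).comp_hasDerivAt l h1
      rw [intervalIntegral.integral_eq_sub_of_hasDerivAt hd]
      · simp
      · refine Continuous.intervalIntegrable ?_ _ _
        exact (((hp s).continuous_fderiv (by norm_num)).comp (by fun_prop)).clm_apply
          continuous_const
    simp_rw [hrep]
    intro s0 hs0
    refine intervalIntegral.continuousWithinAt_of_dominated_interval
      (bound := fun _ => N * ‖y - x0‖) ?_ ?_ intervalIntegrable_const ?_
    · refine Eventually.of_forall fun s => Continuous.aestronglyMeasurable ?_
      exact (((hp s).continuous_fderiv (by norm_num)).comp (by fun_prop)).clm_apply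
          continuous_const
    · filter_upwards [self_mem_nhdsWithin] with s hs
      refine Eventually.of_forall fun l hl => ?_
      rw [uIoc_of_le zero_le_one] at hl
      refine (ContinuousLinearMap.le_opNorm _ _).trans ?_
      gcongr
      exact hb _ (hseg l ⟨hl.1.le, hl.2⟩) s hs
    · refine Eventually.of_forall fun l _ => ?_
      exact (hc _ s0 hs0).clm_apply continuousWithinAt_const
  have hsub : uIoc 0 t ⊆ Icc 0 t := by
    rw [uIoc_of_le ht]; exact Ioc_subset_Icc_self
  refine intervalIntegral.hasFDerivAt_integral_of_dominated_of_fderiv_le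
    (F := fun y s => p s y - p s x0) (F' := fun y s => fderiv ℝ (p s) y)
    (s := Metric.ball x0 r) (bound := fun _ => N) (Metric.isOpen_ball.mem_nhds hx) ?_ ?_ ?_ ?_ ?_ ?_
  · filter_upwards [Metric.isOpen_ball.mem_nhds hx] with y hy
    exact ((key y hy).mono hsub).aestronglyMeasurable measurableSet_uIoc
  · refine ContinuousOn.intervalIntegrable ?_
    rw [uIcc_of_le ht]; exact key x hx
  · exact ((hc x).mono hsub).aestronglyMeasurable measurableSet_uIoc
  · exact Eventually.of_forall fun s hs y hy => hb y hy s (hsub hs)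
  · exact intervalIntegrable_const
  · exact Eventually.of_forall fun s _ y _ => (hdiff s y).sub_const _

lemma fderivP_eq {u : ℝ → E3 → E3} {P : ℝ → E3 → ℝ} {T : ℝ}
    (hu : IsEulerSolutionOn u P T) {s : ℝ} (hs : s ∈ Icc 0 T) (x : E3) :
    fderiv ℝ (P s) x
      = -(innerSL ℝ (deriv (fun s => u s x) s + convF (u s) x)) := by
  have h := hu.momentum s hs x
  have h2 : gradient (P s) x = -(deriv (fun s => u s x) s + convF (u s) x) :=
    eq_neg_of_add_eq_zero_right h
  ext v
  have h3 : ⟪gradient (P s) x, v⟫ = fderiv ℝ (P s) x v := InnerProductSpace.toDual_symm_apply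
  rw [← h3, h2, inner_neg_left]
  rfl

lemma fderivP_cont {u : ℝ → E3 → E3} {P : ℝ → E3 → ℝ} {T : ℝ}
    (hu : IsEulerSolutionOn u P T) (x : E3) :
    ContinuousOn (fun s => fderiv ℝ (P s) x) (Icc 0 T) := by
  have c1 : Continuous fun s => convF (u s) x :=
    (cont_convF hu).comp (by fun_prop : Continuous fun s : ℝ => (s, x))
  have c2 : Continuous (deriv fun s => u s x) := (hu.u_time_C1 x).continuous_deriv (by norm_num)
  have : Continuous fun s => -(innerSL ℝ (deriv (fun s => u s x) s + convF (u s) x)) :=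
    ((innerSL ℝ).continuous.comp (c2.add c1)).neg
  exact this.continuousOn.congr fun s hs => fderivP_eq hu hs x

lemma int_fderivP {u : ℝ → E3 → E3} {P : ℝ → E3 → ℝ} {T : ℝ}
    (hu : IsEulerSolutionOn u P T) {t : ℝ} (ht : t ∈ Icc 0 T) (x : E3) :
    ∫ s in (0:ℝ)..t, fderiv ℝ (P s) x
      = -(innerSL ℝ (u t x - u 0 x + ∫ s in (0:ℝ)..t, convF (u s) x)) := by
  have c1 : Continuous fun s => convF (u s) x :=
    (cont_convF hu).comp (by fun_prop : Continuous fun s : ℝ => (s, x))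
  have c2 : Continuous (deriv fun s => u s x) := (hu.u_time_C1 x).continuous_deriv (by norm_num)
  have e1 : ∫ s in (0:ℝ)..t, fderiv ℝ (P s) x
      = ∫ s in (0:ℝ)..t, -(innerSL ℝ (deriv (fun s => u s x) s + convF (u s) x)) := by
    refine intervalIntegral.integral_congr fun s hs => ?_
    rw [uIcc_of_le ht.1] at hs
    exact fderivP_eq hu ⟨hs.1, hs.2.trans ht.2⟩ x
  have e2 : ∫ s in (0:ℝ)..t, deriv (fun s => u s x) s = u t x - u 0 x :=
    intervalIntegral.integral_deriv_eq_sub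
      (fun s _ => (hu.u_time_C1 x).differentiable (by norm_num) s) (c2.intervalIntegrable _ _)
  have e3 := ContinuousLinearMap.intervalIntegral_comp_comm (innerSL ℝ : E3 →L[ℝ] E3 →L[ℝ] ℝ)
    (f := fun s => deriv (fun s => u s x) s + convF (u s) x)
    ((c2.add c1).intervalIntegrable (μ := volume) 0 t)
  rw [e1, intervalIntegral.integral_neg, e3,
    intervalIntegral.integral_add (c2.intervalIntegrable _ _) (c1.intervalIntegrable _ _), e2]

/-- Points near which the pressure gradient is bounded uniformly in time are dense (Baire). -/
lemma dense_good {u : ℝ → E3 → E3} {P : ℝ → E3 → ℝ} {T : ℝ}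
    (hu : IsEulerSolutionOn u P T) :
    Dense {x0 : E3 | ∃ r > 0, ∃ N : ℝ, ∀ y ∈ Metric.ball x0 r, ∀ s ∈ Icc 0 T,
      ‖fderiv ℝ (P s) y‖ ≤ N} := by
  let f : ℕ → Set E3 := fun n => {y | ∀ s ∈ Icc 0 T, ‖fderiv ℝ (P s) y‖ ≤ n}
  have hc : ∀ n, IsClosed (f n) := by
    intro n
    have : f n = ⋂ s ∈ Icc (0:ℝ) T, {y | ‖fderiv ℝ (P s) y‖ ≤ n} := by
      ext y; simp [f]
    rw [this]
    exact isClosed_biInter fun s _ => isClosed_le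
      ((hu.P_space_C1 s).continuous_fderiv (by norm_num)).norm continuous_const
  have hU : ⋃ n, f n = univ := by
    refine eq_univ_of_forall fun y => ?_
    obtain ⟨C, hC⟩ := isCompact_Icc.exists_bound_of_continuousOn (fderivP_cont hu y)
    obtain ⟨n, hn⟩ := exists_nat_ge C
    exact mem_iUnion.2 ⟨n, fun s hs => (hC s hs).trans hn⟩
  refine (dense_iUnion_interior_of_closed hc hU).mono ?_
  intro x hx
  obtain ⟨n, hn⟩ := mem_iUnion.1 hx
  obtain ⟨r, hr, hball⟩ := Metric.mem_nhds_iff.1 (mem_interior_iff_mem_nhds.1 hn)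
  exact ⟨r, hr, n, fun y hy s hs => hball hy s hs⟩

/-- Antisymmetric part of a linear map, tested against two vectors. -/
def asym (L : E3 →L[ℝ] E3) (v w : E3) : ℝ := ⟪L v, w⟫ - ⟪L w, v⟫

lemma asym_cont (v w : E3) : Continuous fun L : E3 →L[ℝ] E3 => asym L v w := by
  unfold asym
  fun_prop

lemma vort_int_good {u : ℝ → E3 → E3} {P : ℝ → E3 → ℝ} {T : ℝ}
    (hu : IsEulerSolutionOn u P T) {t : ℝ} (ht : t ∈ Icc 0 T) {x0 : E3} {r N : ℝ} (hr : 0 < r)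
    (hb : ∀ y ∈ Metric.ball x0 r, ∀ s ∈ Icc 0 T, ‖fderiv ℝ (P s) y‖ ≤ N) (v w : E3) :
    asym (fderiv ℝ (u t) x0 - fderiv ℝ (u 0) x0 + ∫ s in (0:ℝ)..t, convF' (u s) x0) v w = 0 := by
  have hI : Icc 0 t ⊆ Icc 0 T := Icc_subset_Icc_right ht.2
  have h1 : ∀ᶠ y in 𝓝 x0, HasFDerivAt (fun y => ∫ s in (0:ℝ)..t, (P s y - P s x0))
      (-(innerSL ℝ (u t y - u 0 y + ∫ s in (0:ℝ)..t, convF (u s) y))) y := by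
    filter_upwards [Metric.ball_mem_nhds x0 hr] with y hy
    rw [← int_fderivP hu ht]
    exact potential_hasFDerivAt ht.1 hu.P_space_C1
      (fun y => (fderivP_cont hu y).mono hI) (fun y hy s hs => hb y hy s (hI hs)) hy
  have hd : ∀ s, HasFDerivAt (u s) (fderiv ℝ (u s) x0) x0 := fun s =>
    ((hu.u_space_C2 s).differentiable (by norm_num) x0).hasFDerivAt
  have h2 : HasFDerivAt (fun y => -(innerSL ℝ (u t y - u 0 y + ∫ s in (0:ℝ)..t, convF (u s) y)))
      (-((innerSL ℝ : E3 →L[ℝ] E3 →L[ℝ] ℝ).comp (fderiv ℝ (u t) x0 - fderiv ℝ (u 0) x0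
        + ∫ s in (0:ℝ)..t, convF' (u s) x0))) x0 :=
    ((innerSL ℝ : E3 →L[ℝ] E3 →L[ℝ] ℝ).hasFDerivAt.comp x0
      (((hd t).sub (hd 0)).add (int_convF_hasFDerivAt hu ht x0))).neg
  have h3 := second_derivative_symmetric_of_eventually h1 h2 v w
  have h4 : ∀ L : E3 →L[ℝ] E3, (-((innerSL ℝ : E3 →L[ℝ] E3 →L[ℝ] ℝ).comp L)) v w
      = (-((innerSL ℝ : E3 →L[ℝ] E3 →L[ℝ] ℝ).comp L)) w v → asym L v w = 0 := by
    intro L hL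
    have hL' : -⟪L v, w⟫ = -⟪L w, v⟫ := hL
    unfold asym
    linarith
  exact h4 _ h3

lemma vort_int {u : ℝ → E3 → E3} {P : ℝ → E3 → ℝ} {T : ℝ}
    (hu : IsEulerSolutionOn u P T) {t : ℝ} (ht : t ∈ Icc 0 T) (x : E3) (v w : E3) :
    asym (fderiv ℝ (u t) x - fderiv ℝ (u 0) x + ∫ s in (0:ℝ)..t, convF' (u s) x) v w = 0 := by
  have hc : Continuous fun x =>
      asym (fderiv ℝ (u t) x - fderiv ℝ (u 0) x + ∫ s in (0:ℝ)..t, convF' (u s) x) v w := by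
    refine (asym_cont v w).comp ?_
    have hd : ∀ s, Continuous (fderiv ℝ (u s)) := fun s =>
      (hu.u_space_C2 s).continuous_fderiv (by norm_num)
    refine ((hd t).sub (hd 0)).add ?_
    refine intervalIntegral.continuous_parametric_intervalIntegral_of_continuous'
      (f := fun x s => convF' (u s) x) ?_ 0 t
    exact (cont_convF' hu).comp (continuous_snd.prodMk continuous_fst)
  refine congrFun (hc.ext_on (dense_good hu) continuous_const (g := fun _ => (0:ℝ)) ?_) x
  rintro y ⟨r, hr, N, hb⟩
  exact vort_int_good hu ht hr hb v w

lemma vort_diff {u : ℝ → E3 → E3} {P : ℝ → E3 → ℝ} {T : ℝ}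
    (hu : IsEulerSolutionOn u P T) {t t' : ℝ} (ht : t ∈ Icc 0 T) (ht' : t' ∈ Icc 0 T)
    (x : E3) (v w : E3) :
    asym (fderiv ℝ (u t') x) v w = asym (fderiv ℝ (u t) x) v w
      - (t' - t) * ∫ l in (0:ℝ)..1, asym (convF' (u (t + (t' - t) * l)) x) v w := by
  have c2 : Continuous fun s => convF' (u s) x :=
    (cont_convF' hu).comp (by fun_prop : Continuous fun s : ℝ => (s, x))
  have c3 : Continuous fun s => asym (convF' (u s) x) v w := (asym_cont v w).comp c2
  have h : ∀ t ∈ Icc 0 T, asym (fderiv ℝ (u t) x) v w = asym (fderiv ℝ (u 0) x) v w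
      - ∫ s in (0:ℝ)..t, asym (convF' (u s) x) v w := by
    intro t ht
    have h1 := vort_int hu ht x v w
    have cv : ∀ v, Continuous fun s => convF' (u s) x v := fun v => c2.clm_apply continuous_const
    have h2 : ∀ v w : E3, ⟪(∫ s in (0:ℝ)..t, convF' (u s) x) v, w⟫
        = ∫ s in (0:ℝ)..t, ⟪convF' (u s) x v, w⟫ := by
      intro v w
      rw [ContinuousLinearMap.intervalIntegral_apply (c2.intervalIntegrable _ _)]
      have := ContinuousLinearMap.intervalIntegral_comp_comm (innerSL ℝ w)
        ((cv v).intervalIntegrable (μ := volume) 0 t)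
      simp only [innerSL_apply_apply] at this
      rw [real_inner_comm, ← this]
      exact intervalIntegral.integral_congr fun s _ => real_inner_comm _ _
    have h3 : ∫ s in (0:ℝ)..t, asym (convF' (u s) x) v w
        = (∫ s in (0:ℝ)..t, ⟪convF' (u s) x v, w⟫) - ∫ s in (0:ℝ)..t, ⟪convF' (u s) x w, v⟫ := by
      unfold asym
      exact intervalIntegral.integral_sub
        (((cv v).inner continuous_const).intervalIntegrable _ _)
        (((cv w).inner continuous_const).intervalIntegrable _ _)
    rw [h3, ← h2, ← h2]
    unfold asym at h1 ⊢
    simp only [add_apply, sub_apply, inner_add_left,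
      inner_sub_left] at h1
    linarith
  have h4 := h t ht
  have h5 := h t' ht'
  have h6 := intervalIntegral.integral_interval_sub_left
    (c3.intervalIntegrable (μ := volume) 0 t') (c3.intervalIntegrable (μ := volume) 0 t)
  have h7 : (t' - t) * ∫ l in (0:ℝ)..1, asym (convF' (u (t + (t' - t) * l)) x) v w
      = ∫ s in t..t', asym (convF' (u s) x) v w := by
    have := intervalIntegral.mul_integral_comp_add_mul (a := 0) (b := 1)
      (f := fun s => asym (convF' (u s) x) v w) (t' - t) t
    simpa using this
  rw [h7]
  linarith

/-- Evolution of the antisymmetric part of the velocity gradient along trajectories. -/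
lemma vort_along {u : ℝ → E3 → E3} {P : ℝ → E3 → ℝ} {T : ℝ}
    (hu : IsEulerSolutionOn u P T) {γ : ℝ → E3} {t : ℝ} (ht : t ∈ Ioo 0 T)
    (hγ : HasDerivAt γ (u t (γ t)) t) (v w : E3) :
    HasDerivAt (fun s => asym (fderiv ℝ (u s) (γ s)) v w)
      (-asym ((fderiv ℝ (u t) (γ t)).comp (fderiv ℝ (u t) (γ t))) v w) t := by
  set Φ : ℝ × E3 → ℝ := fun q => ∫ l in (0:ℝ)..1, asym (convF' (u (t + q.1 * l)) q.2) v w with hΦ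
  have hΦc : Continuous Φ := by
    refine intervalIntegral.continuous_parametric_intervalIntegral_of_continuous'
      (f := fun (q : ℝ × E3) (l : ℝ) => asym (convF' (u (t + q.1 * l)) q.2) v w) ?_ 0 1
    refine (asym_cont v w).comp ((cont_convF' hu).comp
      (g := fun q : ℝ × E3 => convF' (u q.1) q.2)
      (f := fun z : (ℝ × E3) × ℝ => (t + z.1.1 * z.2, z.1.2)) (by fun_prop))
  have hΦ0 : Φ (0, γ t) = asym (convF' (u t) (γ t)) v w := by simp [hΦ]
  -- the time increment
  have hA : HasDerivAt (fun s => (s - t) * Φ (s - t, γ s)) (asym (convF' (u t) (γ t)) v w) t := by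
    rw [← hΦ0, hasDerivAt_iff_tendsto_slope]
    have hcont : ContinuousAt (fun s => Φ (s - t, γ s)) t := by
      refine ContinuousAt.comp (g := Φ) hΦc.continuousAt ?_
      exact (continuousAt_id.sub continuousAt_const).prodMk hγ.continuousAt
    have h1 := hcont.tendsto.mono_left (nhdsWithin_le_nhds (s := {t}ᶜ))
    simp only [sub_self] at h1
    refine h1.congr' ?_
    filter_upwards [self_mem_nhdsWithin] with s hs
    have hs' : s - t ≠ 0 := sub_ne_zero.2 hs
    rw [slope_def_field]
    field_simp
    simp
  -- the space increment
  have hJ : HasFDerivAt (fderiv ℝ (u t)) (fderiv ℝ (fderiv ℝ (u t)) (γ t)) (γ t) := by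
    have : ContDiff ℝ 1 (fderiv ℝ (u t)) := (hu.u_space_C2 t).fderiv_right (by norm_num)
    exact (this.differentiable (by norm_num) _).hasFDerivAt
  have hJγ : HasDerivAt (fun s => fderiv ℝ (u t) (γ s))
      (fderiv ℝ (fderiv ℝ (u t)) (γ t) (u t (γ t))) t := hJ.comp_hasDerivAt t hγ
  have hB : HasDerivAt (fun s => asym (fderiv ℝ (u t) (γ s)) v w)
      (asym (fderiv ℝ (fderiv ℝ (u t)) (γ t) (u t (γ t))) v w) t := by
    have e : ∀ v w : E3, HasDerivAt (fun s => ⟪fderiv ℝ (u t) (γ s) v, w⟫)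
        ⟪fderiv ℝ (fderiv ℝ (u t)) (γ t) (u t (γ t)) v, w⟫ t := by
      intro v w
      have h1 := (hJγ.clm_apply (hasDerivAt_const t v)).inner ℝ (hasDerivAt_const t w)
      simpa using h1
    exact (e v w).sub (e w v)
  have hAB := hB.sub hA
  have hsymm : ∀ v : E3, fderiv ℝ (fderiv ℝ (u t)) (γ t) (u t (γ t)) v
      = fderiv ℝ (fderiv ℝ (u t)) (γ t) v (u t (γ t)) := by
    intro v
    exact ((hu.u_space_C2 t).contDiffAt.isSymmSndFDerivAt (by simp)) _ _
  have hval : asym (fderiv ℝ (fderiv ℝ (u t)) (γ t) (u t (γ t))) v w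
      - asym (convF' (u t) (γ t)) v w
      = -asym ((fderiv ℝ (u t) (γ t)).comp (fderiv ℝ (u t) (γ t))) v w := by
    simp only [asym, hsymm, convF'_apply, inner_add_left, ContinuousLinearMap.comp_apply]
    ring
  rw [hval] at hAB
  refine hAB.congr_of_eventuallyEq ?_
  filter_upwards [isOpen_Ioo.mem_nhds ht] with s hs
  exact vort_diff hu (Ioo_subset_Icc_self ht) (Ioo_subset_Icc_self hs) (γ s) v w


lemma inner3 (x y : E3) : ⟪x, y⟫ = x 0 * y 0 + x 1 * y 1 + x 2 * y 2 := by
  simp only [PiLp.inner_apply, Fin.sum_univ_three, RCLike.inner_apply, conj_trivial]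
  ring

lemma inner_e3 (x : E3) (i : Fin 3) : ⟪x, e3 i⟫ = x i := by
  simp [e3, EuclideanSpace.inner_single_right]

lemma clm_coord (L : E3 →L[ℝ] E3) (v : E3) (i : Fin 3) :
    L v i = v 0 * L (e3 0) i + v 1 * L (e3 1) i + v 2 * L (e3 2) i := by
  have hv : v = v 0 • e3 0 + v 1 • e3 1 + v 2 • e3 2 := by
    ext j
    fin_cases j <;> simp [e3]
  conv_lhs => rw [hv]
  simp

lemma asym_e3 (L : E3 →L[ℝ] E3) (i j : Fin 3) :
    asym L (e3 i) (e3 j) = L (e3 i) j - L (e3 j) i := by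
  unfold asym
  rw [inner_e3, inner_e3]

lemma curl_inner (f : E3 → E3) (x z : E3) :
    ⟪curl3 f x, z⟫ = asym (fderiv ℝ f x) (e3 1) (e3 2) * z 0
      + asym (fderiv ℝ f x) (e3 2) (e3 0) * z 1 + asym (fderiv ℝ f x) (e3 0) (e3 1) * z 2 := by
  rw [inner3]
  simp only [asym_e3]
  rfl

lemma curl_coord0 (f : E3 → E3) (x : E3) :
    curl3 f x 0 = fderiv ℝ f x (e3 1) 2 - fderiv ℝ f x (e3 2) 1 := rfl
lemma curl_coord1 (f : E3 → E3) (x : E3) :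
    curl3 f x 1 = fderiv ℝ f x (e3 2) 0 - fderiv ℝ f x (e3 0) 2 := rfl
lemma curl_coord2 (f : E3 → E3) (x : E3) :
    curl3 f x 2 = fderiv ℝ f x (e3 0) 1 - fderiv ℝ f x (e3 1) 0 := rfl

lemma coord_hasDerivAt {z : ℝ → E3} {z' : E3} {t : ℝ} (hz : HasDerivAt z z' t) (i : Fin 3) :
    HasDerivAt (fun s => z s i) (z' i) t :=
  (EuclideanSpace.proj i : E3 →L[ℝ] ℝ).hasFDerivAt.comp_hasDerivAt t hz

/-- Derivative of `⟨ω(t,γ(t)), z(t)⟩` from the vorticity equation. -/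
lemma curl_inner_deriv {u : ℝ → E3 → E3} {P : ℝ → E3 → ℝ} {T : ℝ}
    (hu : IsEulerSolutionOn u P T) {γ : ℝ → E3} {t : ℝ} (ht : t ∈ Ioo 0 T)
    (hγ : HasDerivAt γ (u t (γ t)) t) {z : ℝ → E3} {z' : E3} (hz : HasDerivAt z z' t) :
    HasDerivAt (fun s => ⟪curl3 (u s) (γ s), z s⟫)
      (⟪fderiv ℝ (u t) (γ t) (curl3 (u t) (γ t)), z t⟫ + ⟪curl3 (u t) (γ t), z'⟫) t := by
  have hdiv := hu.incompressible t (Ioo_subset_Icc_self ht) (γ t)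
  simp only [div3, pd3, Fin.sum_univ_three] at hdiv
  simp only [curl_inner]
  have h := (((vort_along hu ht hγ (e3 1) (e3 2)).mul (coord_hasDerivAt hz 0)).add
    ((vort_along hu ht hγ (e3 2) (e3 0)).mul (coord_hasDerivAt hz 1))).add
    ((vort_along hu ht hγ (e3 0) (e3 1)).mul (coord_hasDerivAt hz 2))
  refine h.congr_deriv ?_
  rw [inner3]
  simp only [asym_e3, ContinuousLinearMap.comp_apply]
  set L := fderiv ℝ (u t) (γ t) with hL
  rw [clm_coord L (curl3 (u t) (γ t)) 0, clm_coord L (curl3 (u t) (γ t)) 1,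
    clm_coord L (curl3 (u t) (γ t)) 2, curl_coord0, curl_coord1, curl_coord2, ← hL]
  have hd : ∀ i j, L (L (e3 i)) j = L (e3 i) 0 * L (e3 0) j + L (e3 i) 1 * L (e3 1) j
    + L (e3 i) 2 * L (e3 2) j := fun i j => clm_coord L _ j
  simp only [hd]
  have h2 : L (e3 2) 2 = - L (e3 0) 0 - L (e3 1) 1 := by linarith
  rw [h2]
  ring

lemma curl_inner_cont {u : ℝ → E3 → E3} {P : ℝ → E3 → ℝ} {T : ℝ}
    (hu : IsEulerSolutionOn u P T) {γ z : ℝ → E3} {s : Set ℝ} (hγ : ContinuousOn γ s)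
    (hz : ContinuousOn z s) : ContinuousOn (fun t => ⟪curl3 (u t) (γ t), z t⟫) s := by
  simp only [curl_inner]
  have hJ : ContinuousOn (fun t => fderiv ℝ (u t) (γ t)) s :=
    hu.cont_du.comp_continuousOn (continuousOn_id.prodMk hγ)
  have ha : ∀ v w, ContinuousOn (fun t => asym (fderiv ℝ (u t) (γ t)) v w) s := fun v w =>
    (asym_cont v w).comp_continuousOn hJ
  have hc : ∀ i, ContinuousOn (fun t => z t i) s := fun i =>
    (EuclideanSpace.proj i : E3 →L[ℝ] ℝ).continuous.comp_continuousOn hz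
  exact (((ha _ _).mul (hc 0)).add ((ha _ _).mul (hc 1))).add ((ha _ _).mul (hc 2))

lemma const_of_deriv_zero {f : ℝ → ℝ} {T : ℝ} (hc : ContinuousOn f (Icc 0 T))
    (hd : ∀ t ∈ Ioo 0 T, HasDerivAt f 0 t) : ∀ t ∈ Icc 0 T, f t = f 0 := by
  intro t ht
  rcases ht.1.eq_or_lt with h | h
  · rw [← h]
  · obtain ⟨c, _, hc'⟩ := exists_hasDerivAt_eq_slope f (fun _ => 0) h
      (hc.mono (Icc_subset_Icc_right ht.2)) (fun x hx => hd x ⟨hx.1, hx.2.trans_le ht.2⟩)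
    have h' : t - 0 ≠ 0 := by simpa using h.ne'
    rw [eq_div_iff h'] at hc'
    linarith

/-- (Local conservation of the helicity-type quantity `⟨ω, b⟩`.)
For a smooth bounded Euler solution `(u, P)` on `[0,T] × ℝ³` with vorticity `ω = curl u`,
and a solution `(γ, ξ, b)` of the bicharacteristic-amplitude system along `u` with
`⟨ω(0, γ(0)), ξ(0)⟩ = 0`, the quantity `t ↦ ⟨ω(t, γ(t)), b(t)⟩` is constant on `[0,T]`. -/
theorem stmt8 (T : ℝ) (hT : 0 < T)
    (u : ℝ → E3 → E3) (P : ℝ → E3 → ℝ) (hu : IsEulerSolutionOn u P T)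
    (γ ξ b : ℝ → E3) (hbic : IsBicharSolution u T γ ξ b)
    (h0 : ⟪curl3 (u 0) (γ 0), ξ 0⟫ = 0) :
    ∀ t ∈ Icc 0 T, ⟪curl3 (u t) (γ t), b t⟫ = ⟪curl3 (u 0) (γ 0), b 0⟫ := by
  have hγc : ContinuousOn γ (Icc 0 T) := fun t ht => (hbic.hgamma t ht).continuousAt.continuousWithinAt
  have hξc : ContinuousOn ξ (Icc 0 T) := fun t ht => (hbic.hxi t ht).continuousAt.continuousWithinAt
  have hbc : ContinuousOn b (Icc 0 T) := fun t ht => (hbic.hb t ht).continuousAt.continuousWithinAt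
  have hξ0 : ∀ t ∈ Icc 0 T, ⟪curl3 (u t) (γ t), ξ t⟫ = 0 := by
    intro t ht
    rw [← h0]
    refine const_of_deriv_zero (f := fun t => ⟪curl3 (u t) (γ t), ξ t⟫)
      (curl_inner_cont hu hγc hξc) (fun t ht => ?_) t ht
    have ht' := Ioo_subset_Icc_self ht
    refine (curl_inner_deriv hu ht (hbic.hgamma t ht') (hbic.hxi t ht')).congr_deriv ?_
    have hj : ∀ i, jacT (u t) (γ t) (ξ t) i = ⟪ξ t, fderiv ℝ (u t) (γ t) (e3 i)⟫ := fun _ => rfl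
    rw [inner_neg_right, inner3, inner3 _ (jacT _ _ _)]
    simp only [hj, inner3 (ξ t)]
    rw [clm_coord _ (curl3 (u t) (γ t)) 0, clm_coord _ (curl3 (u t) (γ t)) 1,
      clm_coord _ (curl3 (u t) (γ t)) 2]
    ring
  refine const_of_deriv_zero (f := fun t => ⟪curl3 (u t) (γ t), b t⟫)
    (curl_inner_cont hu hγc hbc) (fun t ht => ?_)
  have ht' := Ioo_subset_Icc_self ht
  refine (curl_inner_deriv hu ht (hbic.hgamma t ht') (hbic.hb t ht')).congr_deriv ?_
  rw [inner_add_right, inner_smul_right, hξ0 t ht', mul_zero, add_zero, inner_neg_right, inner3,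
    inner3]
  rw [clm_coord _ (curl3 (u t) (γ t)) 0, clm_coord _ (curl3 (u t) (γ t)) 1,
    clm_coord _ (curl3 (u t) (γ t)) 2, clm_coord _ (b t) 0, clm_coord _ (b t) 1,
    clm_coord _ (b t) 2, curl_coord0, curl_coord1, curl_coord2]
  ring
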